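/- arXiv:math/0302099 — 2 statements merged into one kernel-verified Lean document; each statement's English description precedes it below -/
import Mathlib

section
/- For every B ∈ B_n: (i) φ_B maps the ideal I^braid_{B^{−1}} onto the ideal I^braid_B; (ii) the algebra automorphism ξ of A_n defined by ξ(a_{ij}) = a_{n+1−i,n+1−j} satisfies ξ ∘ φ_{σ_k} = (φ_{σ_{n−k}})^{−1} ∘ ξ for all 1 ≤ k ≤ n−1, and ξ maps I^braid_{B*} onto I^braid_B, where B* denotes the image of B under the group automorphism of B_n sending σ_k to σ_{n−k}^{−1}. Consequently HC_0(B), HC_0(B^{−1}), and HC_0(B*) are pairwise isomorphic rings. -/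
open scoped BigOperators

/-- Off-diagonal pairs of indices: generators `a_{ij}`, `i ≠ j`. -/
abbrev OffDiag (N : ℕ) := {p : Fin N × Fin N // p.1 ≠ p.2}

/-- The algebra `A_n` for `n = m + 1` strands: the free unital associative `ℤ`-algebra on
the generators `a_{ij}`, `i ≠ j`. -/
abbrev KAlg (m : ℕ) := FreeAlgebra ℤ (OffDiag (m + 1))

/-- `ag i j` is the generator `a_{ij}` for `i ≠ j`, and `-2` on the diagonal. -/
noncomputable def ag {m : ℕ} (i j : Fin (m + 1)) : KAlg m :=
  if h : i = j then (-2 : KAlg m) else FreeAlgebra.ι ℤ (⟨(i, j), h⟩ : OffDiag (m + 1))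

/-- The algebra endomorphism `φ_{σ_k}` of `A_n`. -/
noncomputable def phiSigma {m : ℕ} (k : Fin m) : KAlg m →ₐ[ℤ] KAlg m :=
  FreeAlgebra.lift ℤ (fun p : OffDiag (m + 1) =>
    if p.1.1 = k.castSucc ∧ p.1.2 = k.succ then ag k.succ k.castSucc
    else if p.1.1 = k.succ ∧ p.1.2 = k.castSucc then ag k.castSucc k.succ
    else if p.1.1 = k.castSucc then
      - ag k.succ p.1.2 - ag k.succ k.castSucc * ag k.castSucc p.1.2
    else if p.1.2 = k.castSucc then
      - ag p.1.1 k.succ - ag p.1.1 k.castSucc * ag k.castSucc k.succ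
    else if p.1.1 = k.succ then ag k.castSucc p.1.2
    else if p.1.2 = k.succ then ag p.1.1 k.castSucc
    else ag p.1.1 p.1.2)

/-- The braid relations on the generators `σ_1, …, σ_m` (`m = n - 1`). -/
def braidRels (m : ℕ) : Set (FreeGroup (Fin m)) :=
  {r | (∃ k l : Fin m, (k : ℕ) + 1 = (l : ℕ) ∧
          r = FreeGroup.of k * FreeGroup.of l * FreeGroup.of k *
              (FreeGroup.of l * FreeGroup.of k * FreeGroup.of l)⁻¹) ∨
       (∃ k l : Fin m, (k : ℕ) + 2 ≤ (l : ℕ) ∧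
          r = FreeGroup.of k * FreeGroup.of l * (FreeGroup.of l * FreeGroup.of k)⁻¹)}

/-- The braid group `B_n` on `n = m + 1` strands, presented by `σ_1, …, σ_m`. -/
abbrev BraidGroup (m : ℕ) := PresentedGroup (braidRels m)

/-- The generator `σ_k` of the braid group. -/
def bσ {m : ℕ} (k : Fin m) : BraidGroup m := PresentedGroup.of k

/-- The inclusion `A_n → A_{n+1}` (the extra strand `*` is the last index). -/
noncomputable def embA (m : ℕ) : KAlg m →ₐ[ℤ] KAlg (m + 1) :=
  FreeAlgebra.lift ℤ (fun p : OffDiag (m + 1) =>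
    ag (Fin.castSucc p.1.1) (Fin.castSucc p.1.2))

/-- The matrix `A`, with entries `a_{ij}` off the diagonal and `-2` on the diagonal. -/
noncomputable def matA (m : ℕ) : Matrix (Fin (m + 1)) (Fin (m + 1)) (KAlg m) :=
  Matrix.of fun i j => ag i j

/-- `P` is the matrix `Φ^L_B(A)`, relative to `φ^ext`. -/
def IsPhiL {m : ℕ}
    (φext : BraidGroup m →* (KAlg (m + 1) ≃ₐ[ℤ] KAlg (m + 1)))
    (B : BraidGroup m) (P : Matrix (Fin (m + 1)) (Fin (m + 1)) (KAlg m)) : Prop :=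
  ∀ i : Fin (m + 1),
    φext B (ag (Fin.castSucc i) (Fin.last (m + 1))) =
      ∑ j : Fin (m + 1), embA m (P i j) * ag (Fin.castSucc j) (Fin.last (m + 1))

/-- `P` is the matrix `Φ^R_B(A)`, relative to `φ^ext`. -/
def IsPhiR {m : ℕ}
    (φext : BraidGroup m →* (KAlg (m + 1) ≃ₐ[ℤ] KAlg (m + 1)))
    (B : BraidGroup m) (P : Matrix (Fin (m + 1)) (Fin (m + 1)) (KAlg m)) : Prop :=
  ∀ j : Fin (m + 1),
    φext B (ag (Fin.last (m + 1)) (Fin.castSucc j)) =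
      ∑ i : Fin (m + 1), ag (Fin.castSucc i) (Fin.last (m + 1)) * embA m (P i j)

/-- The ideal `I^braid_B`. -/
noncomputable def Ibraid {m : ℕ} (φ : BraidGroup m →* (KAlg m ≃ₐ[ℤ] KAlg m))
    (B : BraidGroup m) : TwoSidedIdeal (KAlg m) :=
  TwoSidedIdeal.span {x | ∃ i j : Fin (m + 1), i ≠ j ∧ x = ag i j - φ B (ag i j)}

/-- The ideal `I^knot_B`, given the matrices `P = Φ^L_B(A)` and `Q = Φ^R_B(A)`. -/
noncomputable def Iknot {m : ℕ} (P Q : Matrix (Fin (m + 1)) (Fin (m + 1)) (KAlg m)) :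
    TwoSidedIdeal (KAlg m) :=
  TwoSidedIdeal.span
    ({x | ∃ i j, x = ((1 - P) * matA m) i j} ∪ {x | ∃ i j, x = (matA m * (1 - Q)) i j})

/-- The conjugation involution of `A_n`: the anti-automorphism `a_{ij} ↦ a_{ji}`. -/
noncomputable def conjA (m : ℕ) : KAlg m → KAlg m := fun x =>
  ((FreeAlgebra.lift ℤ (fun p : OffDiag (m + 1) =>
      MulOpposite.op (ag p.1.2 p.1.1)) : KAlg m →ₐ[ℤ] (KAlg m)ᵐᵒᵖ) x).unop

/-- The algebra endomorphism `ξ` of `A_n`, `a_{ij} ↦ a_{n+1-i,n+1-j}`. -/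
noncomputable def xiA (m : ℕ) : KAlg m →ₐ[ℤ] KAlg m :=
  FreeAlgebra.lift ℤ (fun p : OffDiag (m + 1) => ag p.1.1.rev p.1.2.rev)

lemma ag_ne {m : ℕ} {i j : Fin (m + 1)} (h : i ≠ j) :
    (ag i j : KAlg m) = FreeAlgebra.ι ℤ (⟨(i, j), h⟩ : OffDiag (m + 1)) := by
  simp [ag, h]

lemma xiA_ag {m : ℕ} (i j : Fin (m + 1)) : xiA m (ag i j) = ag i.rev j.rev := by
  by_cases h : i = j
  · subst h; simpa [ag] using map_ofNat (xiA m) 2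
  · rw [ag_ne h, xiA, FreeAlgebra.lift_ι_apply]

lemma xiA_xiA {m : ℕ} (x : KAlg m) : xiA m (xiA m x) = x := by
  have : (xiA m).comp (xiA m) = AlgHom.id ℤ _ := by
    apply FreeAlgebra.hom_ext
    funext p
    obtain ⟨⟨i, j⟩, h⟩ := p
    have h' : i ≠ j := h
    simp only [Function.comp_apply, AlgHom.comp_apply, AlgHom.id_apply]
    rw [← ag_ne h', xiA_ag, xiA_ag, Fin.rev_rev, Fin.rev_rev]
  exact DFunLike.congr_fun this x

noncomputable def xiEquiv (m : ℕ) : KAlg m ≃ₐ[ℤ] KAlg m :=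
  AlgEquiv.ofAlgHom (xiA m) (xiA m) (AlgHom.ext xiA_xiA) (AlgHom.ext xiA_xiA)

lemma phiSigma_ag {m : ℕ} (k : Fin m) {i j : Fin (m + 1)} (h : i ≠ j) :
    phiSigma k (ag i j) = 
    if i = k.castSucc ∧ j = k.succ then ag k.succ k.castSucc
    else if i = k.succ ∧ j = k.castSucc then ag k.castSucc k.succ
    else if i = k.castSucc then
      - ag k.succ j - ag k.succ k.castSucc * ag k.castSucc j
    else if j = k.castSucc then
      - ag i k.succ - ag i k.castSucc * ag k.castSucc k.succ
    else if i = k.succ then ag k.castSucc j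
    else if j = k.succ then ag i k.castSucc
    else ag i j := by
  conv_lhs => rw [ag_ne h, phiSigma, FreeAlgebra.lift_ι_apply]

lemma phi_xi_phi_ag {m : ℕ} (k : Fin m) {i j : Fin (m + 1)} (h : i ≠ j) :
    phiSigma k.rev (xiA m (phiSigma k (ag i j))) = xiA m (ag i j) := by
  have hc : k.castSucc.rev = k.rev.succ := Fin.rev_castSucc k
  have hs : k.succ.rev = k.rev.castSucc := Fin.rev_succ k
  have hne : k.rev.castSucc ≠ k.rev.succ := (Fin.castSucc_lt_succ).ne
  have hne' : k.castSucc ≠ k.succ := (Fin.castSucc_lt_succ).ne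
  have e1 : ∀ i : Fin (m+1), i ≠ k.castSucc → i.rev ≠ k.rev.succ := by
    intro i hi h; rw [← hc] at h; exact hi (Fin.rev_injective h)
  have e2 : ∀ i : Fin (m+1), i ≠ k.succ → i.rev ≠ k.rev.castSucc := by
    intro i hi h; rw [← hs] at h; exact hi (Fin.rev_injective h)
  by_cases i1 : i = k.castSucc
  · subst i1
    by_cases j1 : j = k.succ
    · subst j1
      rw [phiSigma_ag k h]
      simp [xiA_ag, hc, hs, phiSigma_ag _ hne]
    · have a1 := e1 j h.symm
      have a2 := e2 j j1
      rw [phiSigma_ag k h]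
      simp [j1, h.symm, xiA_ag, hc, hs, phiSigma_ag _ hne, phiSigma_ag _ a1.symm,
        phiSigma_ag _ a2.symm, hne, hne', hne.symm, hne'.symm, a1, a2]
  by_cases j1 : j = k.castSucc
  · subst j1
    by_cases i2 : i = k.succ
    · subst i2
      rw [phiSigma_ag k h]
      simp [xiA_ag, hc, hs, phiSigma_ag _ hne.symm, hne, hne', hne.symm, hne'.symm]
    · have a1 := e1 i i1
      have a2 := e2 i i2
      rw [phiSigma_ag k h]
      simp [i1, i2, xiA_ag, hc, hs, phiSigma_ag _ hne.symm, phiSigma_ag _ a1,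
        phiSigma_ag _ a2, hne, hne', hne.symm, hne'.symm, a1, a2]
  have a1 := e1 i i1
  have b1 := e1 j j1
  by_cases i2 : i = k.succ
  · subst i2
    have b2 := e2 j h.symm
    rw [phiSigma_ag k h]
    simp [i1, j1, xiA_ag, hc, hs, phiSigma_ag _ b1.symm, hne, hne', hne.symm, hne'.symm,
      b1, b2]
  have a2 := e2 i i2
  by_cases j2 : j = k.succ
  · subst j2
    rw [phiSigma_ag k h]
    simp [i1, j1, i2, xiA_ag, hc, hs, phiSigma_ag _ a1, hne, hne', hne.symm, hne'.symm,
      a1, a2]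
  have b2 := e2 j j2
  have hr : i.rev ≠ j.rev := fun h' => h (Fin.rev_injective h')
  rw [phiSigma_ag k h]
  simp [i1, j1, i2, j2, xiA_ag, phiSigma_ag _ hr, a1, a2, b1, b2]

lemma phi_xi_phi {m : ℕ} (k : Fin m) (x : KAlg m) :
    phiSigma k.rev (xiA m (phiSigma k x)) = xiA m x := by
  have : ((phiSigma k.rev).comp (xiA m)).comp (phiSigma k) = xiA m := by
    apply FreeAlgebra.hom_ext
    funext p
    obtain ⟨⟨i, j⟩, h⟩ := p
    have h' : i ≠ j := h
    simp only [Function.comp_apply, AlgHom.comp_apply]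
    rw [← ag_ne h']
    exact phi_xi_phi_ag k h'
  exact DFunLike.congr_fun this x

lemma sub_mem_Ibraid {m : ℕ} (φ : BraidGroup m →* (KAlg m ≃ₐ[ℤ] KAlg m))
    (B : BraidGroup m) (x : KAlg m) : x - φ B x ∈ Ibraid φ B := by
  induction x using FreeAlgebra.induction with
  | grade0 r => simp
  | grade1 p =>
    obtain ⟨⟨i, j⟩, h⟩ := p
    have h' : i ≠ j := h
    rw [← ag_ne h']
    exact TwoSidedIdeal.subset_span ⟨i, j, h', rfl⟩
  | mul a b ha hb =>
    have : a * b - φ B (a * b) = (a - φ B a) * b + φ B a * (b - φ B b) := by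
      rw [map_mul]; noncomm_ring
    rw [this]
    exact (Ibraid φ B).add_mem ((Ibraid φ B).mul_mem_right _ _ ha)
      ((Ibraid φ B).mul_mem_left _ _ hb)
  | add a b ha hb =>
    have : a + b - φ B (a + b) = (a - φ B a) + (b - φ B b) := by
      rw [map_add]; abel
    rw [this]
    exact (Ibraid φ B).add_mem ha hb

lemma Ibraid_le_comap {m : ℕ} (φ : BraidGroup m →* (KAlg m ≃ₐ[ℤ] KAlg m))
    (B C : BraidGroup m) (e : KAlg m ≃ₐ[ℤ] KAlg m)
    (h : ∀ x, e (x - φ C x) ∈ Ibraid φ B) (x : KAlg m) (hx : x ∈ Ibraid φ C) :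
    e x ∈ Ibraid φ B := by
  have : Ibraid φ C ≤ (Ibraid φ B).comap e := by
    unfold Ibraid
    rw [TwoSidedIdeal.span_le]
    rintro _ ⟨i, j, -, rfl⟩
    exact (TwoSidedIdeal.mem_comap _).2 (h _)
  exact (TwoSidedIdeal.mem_comap _).1 (this hx)

lemma image_and_iso {m : ℕ} (φ : BraidGroup m →* (KAlg m ≃ₐ[ℤ] KAlg m))
    (B C : BraidGroup m) (e : KAlg m ≃ₐ[ℤ] KAlg m)
    (h : ∀ x, e (x - φ C x) ∈ Ibraid φ B)
    (h' : ∀ x, e.symm (x - φ B x) ∈ Ibraid φ C) :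
    e '' ((Ibraid φ C : TwoSidedIdeal (KAlg m)) : Set (KAlg m)) =
      ((Ibraid φ B : TwoSidedIdeal (KAlg m)) : Set (KAlg m)) ∧
    Nonempty ((Ibraid φ C).ringCon.Quotient ≃+* (Ibraid φ B).ringCon.Quotient) := by
  have k1 := Ibraid_le_comap φ B C e h
  have k2 := Ibraid_le_comap φ C B e.symm h'
  refine ⟨?_, ?_⟩
  · ext y
    constructor
    · rintro ⟨x, hx, rfl⟩
      exact k1 x hx
    · intro hy
      exact ⟨e.symm y, k2 y hy, by simp⟩
  · refine ⟨RingCon.congr (e : KAlg m ≃+* KAlg m) ?_⟩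
    ext x y
    rw [RingCon.comap_rel, TwoSidedIdeal.rel_iff, TwoSidedIdeal.rel_iff]
    change _ ↔ e x - e y ∈ _
    rw [← map_sub]
    exact ⟨k1 _, fun hh => by simpa using k2 _ hh⟩

/-- (i) `φ_B` maps `I^braid_{B⁻¹}` onto `I^braid_B`; (ii) the automorphism
`ξ : a_{ij} ↦ a_{n+1-i,n+1-j}` satisfies `ξ ∘ φ_{σ_k} = (φ_{σ_{n-k}})⁻¹ ∘ ξ` and maps
`I^braid_{B*}` onto `I^braid_B`, where `B*` is the mirror (`σ_k ↦ σ_{n-k}⁻¹`).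
Consequently `HC₀(B)`, `HC₀(B⁻¹)`, `HC₀(B*)` are pairwise isomorphic. -/
theorem HC0_braid_mirror_inverse (m : ℕ) (hm : 1 ≤ m)
    (φ : BraidGroup m →* (KAlg m ≃ₐ[ℤ] KAlg m))
    (hφ : ∀ (k : Fin m) (x : KAlg m), φ (bσ k) x = phiSigma k x)
    (mir : BraidGroup m →* BraidGroup m)
    (hmir : ∀ k : Fin m, mir (bσ k) = (bσ k.rev)⁻¹)
    (B : BraidGroup m) :
    (φ B) '' ((Ibraid φ B⁻¹ : TwoSidedIdeal (KAlg m)) : Set (KAlg m)) =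
      ((Ibraid φ B : TwoSidedIdeal (KAlg m)) : Set (KAlg m)) ∧
    (∀ (k : Fin m) (x : KAlg m),
      xiA m (phiSigma k x) = φ ((bσ k.rev)⁻¹) (xiA m x)) ∧
    (xiA m) '' ((Ibraid φ (mir B) : TwoSidedIdeal (KAlg m)) : Set (KAlg m)) =
      ((Ibraid φ B : TwoSidedIdeal (KAlg m)) : Set (KAlg m)) ∧
    Nonempty ((Ibraid φ B⁻¹).ringCon.Quotient ≃+* (Ibraid φ B).ringCon.Quotient) ∧
    Nonempty ((Ibraid φ (mir B)).ringCon.Quotient ≃+* (Ibraid φ B).ringCon.Quotient) := by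
  have key : ∀ (k : Fin m) (x : KAlg m),
      xiA m (phiSigma k x) = φ ((bσ k.rev)⁻¹) (xiA m x) := by
    intro k x
    rw [← phi_xi_phi k x, ← hφ k.rev, ← AlgEquiv.mul_apply, ← map_mul]
    simp
  have key2 : ∀ (C : BraidGroup m), xiEquiv m * φ (mir C) * (xiEquiv m)⁻¹ = φ C := by
    have : (MulAut.conj (xiEquiv m)).toMonoidHom.comp (φ.comp mir) = φ := by
      apply PresentedGroup.ext
      intro k
      change xiEquiv m * φ (mir (bσ k)) * (xiEquiv m)⁻¹ = φ (bσ k)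
      rw [hmir, mul_inv_eq_iff_eq_mul, map_inv, mul_inv_eq_iff_eq_mul]
      ext1 x
      simp only [AlgEquiv.mul_apply, hφ]
      have := phi_xi_phi k.rev x
      rw [Fin.rev_rev] at this
      exact this.symm
    intro C
    exact DFunLike.congr_fun this C
  have key3 : ∀ (x : KAlg m), xiEquiv m (φ (mir B) x) = φ B (xiEquiv m x) := by
    intro x
    rw [← key2 B]
    simp [AlgEquiv.mul_apply, AlgEquiv.aut_inv]
  obtain ⟨p1, p2⟩ := image_and_iso φ B B⁻¹ (φ B)
    (by
      intro x
      have := sub_mem_Ibraid φ B x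
      rw [map_sub, ← AlgEquiv.mul_apply, ← map_mul]
      simpa using (Ibraid φ B).neg_mem this)
    (by
      intro x
      have := sub_mem_Ibraid φ B⁻¹ x
      rw [← AlgEquiv.aut_inv, ← map_inv, map_sub, ← AlgEquiv.mul_apply, ← map_mul]
      simpa using (Ibraid φ B⁻¹).neg_mem this)
  obtain ⟨q1, q2⟩ := image_and_iso φ B (mir B) (xiEquiv m)
    (by
      intro x
      rw [map_sub, key3]
      exact sub_mem_Ibraid φ B _)
    (by
      intro x
      have := sub_mem_Ibraid φ (mir B) ((xiEquiv m).symm x)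
      have e : (xiEquiv m).symm (φ B x) = φ (mir B) ((xiEquiv m).symm x) := by
        rw [AlgEquiv.symm_apply_eq, key3, AlgEquiv.apply_symm_apply]
      rw [map_sub, e]
      exact this)
  exact ⟨p1, key, q1, p2, q2⟩
end

section
/- Let B ∈ B_n be any braid word and let v ∈ ℤ^n; set w = β_{B̂}·v, where B̂ is the reverse of the word B. Then for all 1 ≤ i ≠ j ≤ n, ρ_v(φ_B(a_{ij})) = q_{w_i − w_j}; equivalently, ρ_v ∘ φ_B = ρ_{β_{B̂}v} as ring homomorphisms A_n → ℤ[x]. -/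
open scoped BigOperators

/-- The polynomials `q_m`: `q_0 = -2`, `q_1 = -x`, `q_{m+1} = x·q_m - q_{m-1}`. -/
noncomputable def qPol : ℕ → Polynomial ℤ
  | 0 => -2
  | 1 => -Polynomial.X
  | (m + 2) => Polynomial.X * qPol (m + 1) - qPol m

/-- The extension of `q` to all integers via the recursion; it satisfies `q_{-m} = q_m`. -/
noncomputable def qZ (k : ℤ) : Polynomial ℤ := qPol k.natAbs

/-- Burau matrix (at `t = -1`) of `σ_k`: the identity except for the `2×2` block
`[[2,-1],[1,0]]` in rows/columns `k, k+1`. -/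
def bmat {m : ℕ} (k : Fin m) : Matrix (Fin (m + 1)) (Fin (m + 1)) ℤ :=
  Matrix.of fun i j =>
    if i = k.castSucc ∧ j = k.castSucc then 2
    else if i = k.castSucc ∧ j = k.succ then -1
    else if i = k.succ ∧ j = k.castSucc then 1
    else if i = k.succ ∧ j = k.succ then 0
    else if i = j then 1 else 0

/-- Burau matrix (at `t = -1`) of `σ_k⁻¹`. -/
def bmatInv {m : ℕ} (k : Fin m) : Matrix (Fin (m + 1)) (Fin (m + 1)) ℤ :=
  Matrix.of fun i j =>
    if i = k.castSucc ∧ j = k.castSucc then 0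
    else if i = k.castSucc ∧ j = k.succ then 1
    else if i = k.succ ∧ j = k.castSucc then -1
    else if i = k.succ ∧ j = k.succ then 2
    else if i = j then 1 else 0

/-- The Burau matrix (at `t = -1`) of a braid word (a letter `(k, true)` is `σ_k`, and
`(k, false)` is `σ_k⁻¹`). -/
def burauWord {m : ℕ} (w : List (Fin m × Bool)) : Matrix (Fin (m + 1)) (Fin (m + 1)) ℤ :=
  (w.map fun p => if p.2 then bmat p.1 else bmatInv p.1).prod

/-- The element of the braid group represented by a braid word. -/
def toBraid {m : ℕ} (w : List (Fin m × Bool)) : BraidGroup m :=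
  (w.map fun p => if p.2 then bσ p.1 else (bσ p.1)⁻¹).prod

/-- The ring homomorphism `ρ_v : A_n → ℤ[x]`, `a_{ij} ↦ q_{v_i - v_j}`. -/
noncomputable def rho {m : ℕ} (v : Fin (m + 1) → ℤ) : KAlg m →ₐ[ℤ] Polynomial ℤ :=
  FreeAlgebra.lift ℤ (fun p : OffDiag (m + 1) => qZ (v p.1.1 - v p.1.2))

theorem qZ_neg' (k : ℤ) : qZ (-k) = qZ k := by simp [qZ]

theorem qZ_nat_rec (n : ℕ) : qZ ((n : ℤ) + 2) = Polynomial.X * qZ ((n : ℤ) + 1) - qZ n := by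
  have h2 : ((n : ℤ) + 2).natAbs = n + 2 := by omega
  have h1 : ((n : ℤ) + 1).natAbs = n + 1 := by omega
  have h0 : (n : ℤ).natAbs = n := by omega
  simp only [qZ, h2, h1, h0, qPol]

theorem qZ_rec (k : ℤ) : qZ (k + 1) = Polynomial.X * qZ k - qZ (k - 1) := by
  rcases lt_trichotomy k 0 with h | h | h
  · obtain ⟨n, hn⟩ : ∃ n : ℕ, k = -((n : ℤ) + 1) := ⟨(-k - 1).toNat, by omega⟩
    have e1 : k + 1 = -(n : ℤ) := by omega
    have e2 : k - 1 = -((n : ℤ) + 2) := by omega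
    rw [e1, e2, hn, qZ_neg', qZ_neg', qZ_neg', qZ_nat_rec]; ring
  · subst h
    simp [qZ, qPol]; ring
  · obtain ⟨n, hn⟩ : ∃ n : ℕ, k = (n : ℤ) + 1 := ⟨(k - 1).toNat, by omega⟩
    have e1 : k + 1 = (n : ℤ) + 2 := by omega
    have e2 : k - 1 = (n : ℤ) := by omega
    rw [e1, e2, hn, qZ_nat_rec]

theorem qZ_mul_nat (n : ℕ) (b : ℤ) :
    qZ n * qZ b = -(qZ (n + b) + qZ (n - b)) ∧
    qZ (n + 1) * qZ b = -(qZ (n + 1 + b) + qZ (n + 1 - b)) := by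
  induction n with
  | zero =>
    have h0 : qZ 0 = -2 := by simp [qZ, qPol]
    have h1 : qZ 1 = -Polynomial.X := by simp [qZ, qPol]
    constructor
    · simp [h0, qZ_neg']; ring
    · have := qZ_rec b
      have e : (1 : ℤ) - b = -(b - 1) := by ring
      simp only [Nat.cast_zero, zero_add, h1]
      rw [e, qZ_neg', add_comm 1 b, this]; ring
  | succ n ih =>
    refine ⟨by push_cast; exact ih.2, ?_⟩
    push_cast
    have r1 := qZ_rec ((n : ℤ) + 1)
    have r2 := qZ_rec ((n : ℤ) + 1 + b)
    have r3 := qZ_rec ((n : ℤ) + 1 - b)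
    rw [show (n : ℤ) + 1 + b + 1 = n + 1 + 1 + b by ring,
      show (n : ℤ) + 1 + b - 1 = n + b by ring] at r2
    rw [show (n : ℤ) + 1 - b + 1 = n + 1 + 1 - b by ring,
      show (n : ℤ) + 1 - b - 1 = n - b by ring] at r3
    rw [show (n : ℤ) + 1 - 1 = n by ring] at r1
    rw [r1, r2, r3]
    linear_combination Polynomial.X * ih.2 - ih.1

theorem qZ_mul (a b : ℤ) : qZ a * qZ b = -(qZ (a + b) + qZ (a - b)) := by
  rcases le_total 0 a with h | h
  · obtain ⟨n, rfl⟩ := Int.eq_ofNat_of_zero_le h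
    exact (qZ_mul_nat n b).1
  · obtain ⟨n, hn⟩ := Int.eq_ofNat_of_zero_le (neg_nonneg.mpr h)
    have e : a = -(n : ℤ) := by omega
    subst e
    rw [qZ_neg', (qZ_mul_nat n b).1, ← qZ_neg' (-(n : ℤ) + b), ← qZ_neg' (-(n : ℤ) - b)]
    rw [show -(-(n : ℤ) + b) = n - b by ring, show -(-(n : ℤ) - b) = n + b by ring]
    ring

theorem rho_ag {m : ℕ} (v : Fin (m + 1) → ℤ) (i j : Fin (m + 1)) :
    rho v (ag i j) = qZ (v i - v j) := by
  unfold ag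
  split_ifs with h
  · subst h; simpa [qZ, qPol] using map_ofNat (rho v) 2
  · simp [rho]

theorem bmat_mulVec {m : ℕ} (k : Fin m) (v : Fin (m + 1) → ℤ) (i : Fin (m + 1)) :
    (bmat k).mulVec v i = if i = k.castSucc then 2 * v k.castSucc - v k.succ
      else if i = k.succ then v k.castSucc else v i := by
  have hne : k.succ ≠ k.castSucc := k.castSucc_lt_succ.ne'
  have : ∀ j, bmat k i j * v j = if i = k.castSucc then
        (if j = k.castSucc then 2 * v k.castSucc else 0) - (if j = k.succ then v k.succ else 0)
      else if i = k.succ then (if j = k.castSucc then v k.castSucc else 0)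
      else (if j = i then v i else 0) := by
    intro j
    simp only [bmat, Matrix.of_apply]
    grind
  simp only [Matrix.mulVec, dotProduct, this]
  split_ifs <;> simp

theorem bmatInv_mulVec {m : ℕ} (k : Fin m) (v : Fin (m + 1) → ℤ) (i : Fin (m + 1)) :
    (bmatInv k).mulVec v i = if i = k.castSucc then v k.succ
      else if i = k.succ then 2 * v k.succ - v k.castSucc else v i := by
  have hne : k.succ ≠ k.castSucc := k.castSucc_lt_succ.ne'
  have : ∀ j, bmatInv k i j * v j = if i = k.castSucc then
        (if j = k.succ then v k.succ else 0)
      else if i = k.succ then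
        (if j = k.succ then 2 * v k.succ else 0) - (if j = k.castSucc then v k.castSucc else 0)
      else (if j = i then v i else 0) := by
    intro j
    simp only [bmatInv, Matrix.of_apply]
    grind
  simp only [Matrix.mulVec, dotProduct, this]
  split_ifs <;> simp

theorem bmat_bmatInv {m : ℕ} (k : Fin m) (v : Fin (m + 1) → ℤ) :
    (bmat k).mulVec ((bmatInv k).mulVec v) = v := by
  have hne : k.succ ≠ k.castSucc := k.castSucc_lt_succ.ne'
  funext i
  simp only [bmat_mulVec, bmatInv_mulVec]
  grind

theorem rho_phiSigma {m : ℕ} (k : Fin m) (v : Fin (m + 1) → ℤ) (x : KAlg m) :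
    rho v (phiSigma k x) = rho ((bmat k).mulVec v) x := by
  have hne : k.succ ≠ k.castSucc := k.castSucc_lt_succ.ne'
  suffices h : (rho v).comp (phiSigma k) = rho ((bmat k).mulVec v) from DFunLike.congr_fun h x
  apply FreeAlgebra.hom_ext
  funext ⟨⟨i, j⟩, hij⟩
  simp only [ne_eq] at hij
  simp only [Function.comp_apply, AlgHom.comp_apply, phiSigma, FreeAlgebra.lift_ι_apply]
  have hr : rho ((bmat k).mulVec v) (FreeAlgebra.ι ℤ (⟨(i, j), hij⟩ : OffDiag (m + 1))) =
    qZ ((bmat k).mulVec v i - (bmat k).mulVec v j) := by simp [rho]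
  rw [hr, bmat_mulVec, bmat_mulVec]
  by_cases h1 : i = k.castSucc
  · subst h1
    by_cases h2 : j = k.succ
    · subst h2
      simp only [and_self, if_true, if_neg hne, rho_ag]
      rw [← qZ_neg']; congr 1; ring
    · have h3 : j ≠ k.castSucc := fun h => hij h.symm
      simp only [h2, h3, hne.symm, and_false, if_false, if_true, map_sub, map_neg, map_mul,
        rho_ag, qZ_mul]
      rw [← qZ_neg' (2 * _ - _ - _),
        show v k.succ - v k.castSucc + (v k.castSucc - v j) = v k.succ - v j by ring,
        show v k.succ - v k.castSucc - (v k.castSucc - v j) =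
          -(2 * v k.castSucc - v k.succ - v j) by ring]
      ring
  · by_cases h2 : j = k.castSucc
    · subst h2
      by_cases h3 : i = k.succ
      · subst h3
        simp only [hne, hne.symm, and_self, false_and, if_false, if_true, rho_ag]
        rw [← qZ_neg']; congr 1; ring
      · simp only [h1, h3, false_and, if_false, if_true, map_sub, map_neg, map_mul,
          rho_ag, qZ_mul]
        rw [show v i - v k.castSucc + (v k.castSucc - v k.succ) = v i - v k.succ by ring,
          show v i - v k.castSucc - (v k.castSucc - v k.succ) =
            v i - (2 * v k.castSucc - v k.succ) by ring]
        ring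
    · by_cases h3 : i = k.succ
      · have h4 : j ≠ k.succ := fun h => hij (h3.trans h.symm)
        subst h3
        simp only [h2, h4, hne, and_false, false_and, if_false, if_true, rho_ag]
      · by_cases h4 : j = k.succ
        · subst h4
          simp only [h1, h2, h3, and_false, false_and, if_false, if_true, rho_ag]
        · simp only [h1, h2, h3, h4, and_false, if_false, rho_ag]

theorem rho_phi_word {m : ℕ} (φ : BraidGroup m →* (KAlg m ≃ₐ[ℤ] KAlg m))
    (hφ : ∀ (k : Fin m) (x : KAlg m), φ (bσ k) x = phiSigma k x)
    (w : List (Fin m × Bool)) : ∀ (v : Fin (m + 1) → ℤ) (x : KAlg m),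
    rho v (φ (toBraid w) x) = rho ((burauWord w.reverse).mulVec v) x := by
  induction w with
  | nil => intro v x; simp [toBraid, burauWord]
  | cons p w ih =>
    intro v x
    have e1 : toBraid (p :: w) = (if p.2 then bσ p.1 else (bσ p.1)⁻¹) * toBraid w := by
      simp [toBraid]
    have e2 : burauWord (p :: w).reverse =
        burauWord w.reverse * (if p.2 then bmat p.1 else bmatInv p.1) := by
      simp [burauWord]
    rw [e1, e2, map_mul, AlgEquiv.mul_apply, ← Matrix.mulVec_mulVec, ← ih]
    generalize φ (toBraid w) x = y
    obtain ⟨k, b⟩ := p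
    cases b
    · simp only [Bool.false_eq_true, if_false]
      have h := rho_phiSigma k ((bmatInv k).mulVec v) (φ (bσ k)⁻¹ y)
      rw [← hφ, ← AlgEquiv.mul_apply, ← map_mul, mul_inv_cancel, map_one, AlgEquiv.one_apply,
        bmat_bmatInv] at h
      exact h.symm
    · simp only [if_true]
      rw [hφ, rho_phiSigma]

/-- for a braid word `B` with reverse `B̂` and `w = β_{B̂}·v`, one has
`ρ_v(φ_B(a_{ij})) = q_{w_i - w_j}`; equivalently `ρ_v ∘ φ_B = ρ_{β_{B̂}v}`. -/
theorem rho_phi_eq_rho_burau (m : ℕ) (hm : 1 ≤ m)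
    (φ : BraidGroup m →* (KAlg m ≃ₐ[ℤ] KAlg m))
    (hφ : ∀ (k : Fin m) (x : KAlg m), φ (bσ k) x = phiSigma k x)
    (w : List (Fin m × Bool)) (v : Fin (m + 1) → ℤ) :
    (∀ i j : Fin (m + 1), i ≠ j →
      rho v (φ (toBraid w) (ag i j)) =
        qZ ((burauWord w.reverse).mulVec v i - (burauWord w.reverse).mulVec v j)) ∧
    (∀ x : KAlg m, rho v (φ (toBraid w) x) = rho ((burauWord w.reverse).mulVec v) x) := by
  have h := rho_phi_word φ hφ w v
  exact ⟨fun i j _ => by rw [h, rho_ag], h⟩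
end
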